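/- The theory ZF − Union does not prove the Finite Union principle: there exists a model of ZF − Union containing elements x and y such that no element u of the model satisfies ∀z (z ∈ u ↔ z ∈ x ∨ z ∈ y). Equivalently, the theory (ZF − Union) ∪ {¬∀x∀y∃u∀z (z ∈ u ↔ z ∈ x ∨ z ∈ y)} is satisfiable. -/

import Mathlib

/-!
Statement 2: ZF − Union does not prove the Finite Union principle: there is a
model of ZF − Union containing elements `x` and `y` whose union `x ∪ y` does not
exist in the model.
-/

open FirstOrder FirstOrder.Language

/-- The relation symbols for the language `{∈}`: a single binary relation. -/
inductive memRel : ℕ → Type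
  | mem : memRel 2

/-- The first-order language with a single binary relation symbol `∈`. -/
def Lmem : FirstOrder.Language := ⟨fun _ => Empty, memRel⟩

/-- A binary relation on `M` interprets the language `{∈}`. -/
def memStructure {M : Type*} (mem : M → M → Prop) : Lmem.Structure M where
  funMap := fun f _ => f.elim
  RelMap | .mem => fun x => mem (x 0) (x 1)

section Axioms

variable (M : Type*) (mem : M → M → Prop)

/-- Extensionality. -/
def AxExt : Prop := ∀ x y : M, (∀ z, mem z x ↔ mem z y) → x = y

/-- Pairing. -/
def AxPairing : Prop := ∀ a b : M, ∃ p : M, ∀ z, mem z p ↔ (z = a ∨ z = b)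

/-- Power Set. -/
def AxPower : Prop := ∀ x : M, ∃ P : M, ∀ z, mem z P ↔ ∀ w, mem w z → mem w x

/-- Infinity: there is a set containing an empty set and closed under successor
`x ↦ x ∪ {x}`. -/
def AxInfinity : Prop :=
  ∃ I : M, (∃ e, mem e I ∧ ∀ z, ¬ mem z e) ∧
    ∀ x, mem x I → ∃ s, mem s I ∧ ∀ z, mem z s ↔ (mem z x ∨ z = x)

/-- Foundation: every nonempty set has an `∈`-minimal element. -/
def AxFound : Prop :=
  ∀ x : M, (∃ y, mem y x) → ∃ y, mem y x ∧ ∀ z, ¬ (mem z y ∧ mem z x)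

/-- The Comprehension schema for the language `{∈}`: for every first-order formula
`φ(z, p̄)` of `{∈}`, every set `x` and parameters `p̄`, the set `{z ∈ x : φ(z, p̄)}` exists. -/
def AxComp : Prop :=
  ∀ (n : ℕ) (φ : Lmem.Formula (Fin (n + 1))) (x : M) (p : Fin n → M),
    ∃ s : M, ∀ z, mem z s ↔
      (mem z x ∧ (letI := memStructure mem; φ.Realize (Fin.cons z p)))

/-- The Replacement schema for the language `{∈}`: if the formula `φ(x, y, p̄)`
defines a function on the members of `a`, then the image of `a` under it is a set. -/
def AxRepl : Prop :=
  ∀ (n : ℕ) (φ : Lmem.Formula (Fin (n + 2))) (a : M) (p : Fin n → M),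
    (∀ x, mem x a → ∃! y,
        (letI := memStructure mem; φ.Realize (Fin.cons x (Fin.cons y p)))) →
    ∃ b : M, ∀ y, mem y b ↔ ∃ x, mem x a ∧
        (letI := memStructure mem; φ.Realize (Fin.cons x (Fin.cons y p)))

/-- The theory ZF − Union: Extensionality, Pairing, Power Set, Infinity, Foundation,
the Comprehension schema, and the Replacement schema (but no Union axiom). -/
def ZFminusUnion : Prop :=
  AxExt M mem ∧ AxPairing M mem ∧ AxPower M mem ∧ AxInfinity M mem ∧
    AxFound M mem ∧ AxComp M mem ∧ AxRepl M mem

end Axioms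

namespace TreeModel

/-! ### A universe of sets over a tree of nodes -/

/-- The code of a node of the tree `List ℕ`; the children of `l` are the lists `n :: l`. -/
noncomputable def node (l : List ℕ) : ZFSet.{0} :=
  ((Encodable.encode l : ℕ) : Ordinal.{0}).toZFSet

/-- The set of codes of the children of a node. -/
noncomputable def children (l : List ℕ) : ZFSet.{0} :=
  ZFSet.range fun n : ℕ => node (n :: l)

theorem node_injective : Function.Injective node := fun a b h => by
  have := Ordinal.toZFSet_injective h
  exact Encodable.encode_injective (by exact_mod_cast this)

theorem rank_node (l : List ℕ) : (node l).rank = ((Encodable.encode l : ℕ) : Ordinal.{0}) :=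
  Ordinal.rank_toZFSet _

theorem mem_children {l : List ℕ} {y : ZFSet.{0}} :
    y ∈ children l ↔ ∃ n, y = node (n :: l) := by
  simp [children, eq_comm]

theorem rank_node_lt_rank_children (l m : List ℕ) : (node l).rank < (children m).rank := by
  rw [ZFSet.lt_rank_iff]
  refine ⟨node (Encodable.encode l :: m), mem_children.2 ⟨_, rfl⟩, ?_⟩
  rw [rank_node, rank_node, Encodable.encode_list_cons]
  exact_mod_cast (Nat.left_le_pair _ _).trans (Nat.le_succ _)

theorem node_ne_children (l m : List ℕ) : node l ≠ children m := fun h =>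
  (rank_node_lt_rank_children l m).ne (congrArg ZFSet.rank h)

theorem children_injective : Function.Injective children := fun l m h => by
  have h0 : node (0 :: l) ∈ children m := h ▸ mem_children.2 ⟨0, rfl⟩
  obtain ⟨n, hn⟩ := mem_children.1 h0
  exact (List.cons.inj (node_injective hn)).2

open Classical in
/-- The involution of the universe exchanging each node with its set of children. -/
noncomputable def swapNode (x : ZFSet.{0}) : ZFSet.{0} :=
  if h : ∃ l, x = node l then children h.choose
  else if h : ∃ l, x = children l then node h.choose
  else x

theorem swapNode_node (l : List ℕ) : swapNode (node l) = children l := by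
  have h : ∃ m, node l = node m := ⟨l, rfl⟩
  rw [swapNode, dif_pos h, ← node_injective h.choose_spec]

theorem swapNode_children (l : List ℕ) : swapNode (children l) = node l := by
  have h : ∃ m, children l = children m := ⟨l, rfl⟩
  rw [swapNode, dif_neg (fun ⟨m, hm⟩ => node_ne_children m l hm.symm), dif_pos h,
    ← children_injective h.choose_spec]

theorem swapNode_of_ne {x : ZFSet.{0}} (h₁ : ∀ l, x ≠ node l) (h₂ : ∀ l, x ≠ children l) :
    swapNode x = x := by
  rw [swapNode, dif_neg (not_exists.2 h₁), dif_neg (not_exists.2 h₂)]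

theorem swapNode_involutive : Function.Involutive swapNode := fun x => by
  by_cases h₁ : ∃ l, x = node l
  · obtain ⟨l, rfl⟩ := h₁
    rw [swapNode_node, swapNode_children]
  by_cases h₂ : ∃ l, x = children l
  · obtain ⟨l, rfl⟩ := h₂
    rw [swapNode_children, swapNode_node]
  rw [swapNode_of_ne (not_exists.1 h₁) (not_exists.1 h₂),
    swapNode_of_ne (not_exists.1 h₁) (not_exists.1 h₂)]

/-- The twisted membership relation, for which the members of a node are its children. -/
def E (y x : ZFSet.{0}) : Prop := y ∈ swapNode x

theorem E_ext {x y : ZFSet.{0}} (h : ∀ z, E z x ↔ E z y) : x = y :=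
  swapNode_involutive.injective (ZFSet.ext h)

theorem E_node {l : List ℕ} {y : ZFSet.{0}} : E y (node l) ↔ ∃ n, y = node (n :: l) := by
  rw [E, swapNode_node, mem_children]

theorem exists_E_iff (S : Set ZFSet.{0}) [Small.{0} S] : ∃ x, ∀ y, E y x ↔ y ∈ S :=
  ⟨swapNode (ZFSet.range ((↑) : S → ZFSet.{0})), fun y => by
    simp [E, swapNode_involutive _]⟩

instance small_setOf_E (x : ZFSet.{0}) : Small.{0} {y | E y x} :=
  ZFSet.small_coe (swapNode x)

theorem rank_lt_of_E {x y : ZFSet.{0}} (hx : ∀ l, x ≠ node l) (h : E y x) : y.rank < x.rank := by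
  by_cases h₂ : ∃ l, x = children l
  · obtain ⟨l, rfl⟩ := h₂
    rw [E, swapNode_children] at h
    exact (ZFSet.rank_lt_of_mem h).trans (rank_node_lt_rank_children l l)
  · rw [E, swapNode_of_ne hx (not_exists.1 h₂)] at h
    exact ZFSet.rank_lt_of_mem h

/-- Induction along twisted membership, with the nodes as base cases. -/
theorem E_induction {p : ZFSet.{0} → Prop} (node : ∀ l, p (node l))
    (set : ∀ x, (∀ y, E y x → p y) → p x) (x : ZFSet.{0}) : p x := by
  induction hr : x.rank using WellFoundedLT.induction generalizing x with
  | ind r ih =>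
    by_cases hx : ∃ l, x = TreeModel.node l
    · obtain ⟨l, rfl⟩ := hx
      exact node l
    · exact set x fun y hy => ih _ (hr ▸ rank_lt_of_E (not_exists.1 hx) hy) y rfl

/-! ### Automorphisms -/

/-- The automorphism group of the tree `List ℕ`. -/
def treeAut : Subgroup (Equiv.Perm (List ℕ)) where
  carrier := {g | ∀ l, (g l).tail = g l.tail}
  one_mem' _ := rfl
  mul_mem' {a b} ha hb l := by
    rw [Equiv.Perm.mul_apply, ha, hb, Equiv.Perm.mul_apply]
  inv_mem' {a} ha l := by
    apply a.injective
    rw [← ha]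
    simp

theorem treeAut_nil (g : treeAut) : g.1 [] = [] := by
  have h := congrArg List.length (g.2 [])
  simp only [List.length_tail, List.tail_nil] at h
  exact List.length_eq_zero_iff.1 (by omega)

theorem treeAut_tail (g : treeAut) (l : List ℕ) : (g.1 l).tail = g.1 l.tail := g.2 l

theorem treeAut_cons (g : treeAut) (n : ℕ) (l : List ℕ) : ∃ m, g.1 (n :: l) = m :: g.1 l := by
  have h := treeAut_tail g (n :: l)
  cases hg : g.1 (n :: l) with
  | nil => exact absurd (g.1.injective (hg.trans (treeAut_nil g).symm)) (by simp)
  | cons m k =>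
    rw [hg] at h
    exact ⟨m, by rw [← show k = g.1 l from h]⟩

theorem exists_treeAut_cons (g : treeAut) (m : ℕ) (l : List ℕ) :
    ∃ n, g.1 (n :: l) = m :: g.1 l := by
  obtain ⟨n, hn⟩ := treeAut_cons g⁻¹ m (g.1 l)
  refine ⟨n, ?_⟩
  have := congrArg g.1 hn
  simpa using this.symm

open Classical in
/-- The action of tree automorphisms on the universe. -/
noncomputable def act (g : treeAut) (x : ZFSet.{0}) : ZFSet.{0} :=
  if h : ∃ l, x = node l then node (g.1 h.choose)
  else swapNode (ZFSet.range fun y : {y | E y x} =>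
    have := rank_lt_of_E (not_exists.1 h) y.2
    act g y)
termination_by x.rank

theorem act_node (g : treeAut) (l : List ℕ) : act g (node l) = node (g.1 l) := by
  have h : ∃ m, node l = node m := ⟨l, rfl⟩
  rw [act, dif_pos h, ← node_injective h.choose_spec]

theorem E_act {g : treeAut} {x z : ZFSet.{0}} : E z (act g x) ↔ ∃ y, E y x ∧ z = act g y := by
  by_cases h : ∃ l, x = node l
  · obtain ⟨l, rfl⟩ := h
    rw [act_node, E_node]
    constructor
    · rintro ⟨m, rfl⟩
      obtain ⟨n, hn⟩ := exists_treeAut_cons g m l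
      exact ⟨node (n :: l), E_node.2 ⟨n, rfl⟩, by rw [act_node, hn]⟩
    · rintro ⟨y, hy, rfl⟩
      obtain ⟨n, rfl⟩ := E_node.1 hy
      obtain ⟨m, hm⟩ := treeAut_cons g n l
      exact ⟨m, by rw [act_node, hm]⟩
  · rw [act, dif_neg h, E, swapNode_involutive]
    simp [eq_comm]

theorem act_mul (g h : treeAut) (x : ZFSet.{0}) : act (g * h) x = act g (act h x) := by
  induction x using E_induction with
  | node l => simp only [act_node]; rfl
  | set x ih =>
    refine E_ext fun z => ?_
    simp only [E_act]
    constructor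
    · rintro ⟨y, hy, rfl⟩
      exact ⟨_, ⟨y, hy, rfl⟩, ih y hy⟩
    · rintro ⟨_, ⟨y, hy, rfl⟩, rfl⟩
      exact ⟨y, hy, (ih y hy).symm⟩

theorem act_one (x : ZFSet.{0}) : act 1 x = x := by
  induction x using E_induction with
  | node l => rw [act_node]; rfl
  | set x ih =>
    refine E_ext fun z => ?_
    rw [E_act]
    constructor
    · rintro ⟨y, hy, rfl⟩
      rwa [ih y hy]
    · exact fun hz => ⟨z, hz, (ih z hz).symm⟩

noncomputable instance : MulAction treeAut ZFSet.{0} where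
  smul := act
  one_smul := act_one
  mul_smul := act_mul

theorem smul_node (g : treeAut) (l : List ℕ) : g • node l = node (g.1 l) := act_node g l

theorem E_smul {g : treeAut} {x z : ZFSet.{0}} : E z (g • x) ↔ ∃ y, E y x ∧ z = g • y := E_act

theorem smul_E_smul {g : treeAut} {x y : ZFSet.{0}} : E (g • y) (g • x) ↔ E y x := by
  simp [E_smul]

/-! ### The model -/

/-- The element `x` has a finite support `F`, and its members are jointly supported by `F` together
with the children of a single node. -/
def Tame (x : ZFSet.{0}) : Prop :=
  ∃ (F : Finset (List ℕ)) (c : List ℕ), ∀ g : treeAut, (∀ l ∈ F, g.1 l = l) →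
    g • x = x ∧ ((∀ n, g.1 (n :: c) = n :: c) → ∀ y, E y x → g • y = y)

/-- The hereditarily tame elements of the universe. -/
inductive HTame : ZFSet.{0} → Prop
  | node (l : List ℕ) : HTame (node l)
  | set {x : ZFSet.{0}} (hx : Tame x) (h : ∀ y, E y x → HTame y) : HTame x

theorem tame_node (l : List ℕ) : Tame (node l) := by
  refine ⟨{l}, l, fun g hg => ⟨?_, fun hc y hy => ?_⟩⟩
  · rw [smul_node, hg l (Finset.mem_singleton_self l)]
  · obtain ⟨n, rfl⟩ := E_node.1 hy
    rw [smul_node, hc]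

theorem HTame.tame {x : ZFSet.{0}} (h : HTame x) : Tame x := by
  cases h with
  | node l => exact tame_node l
  | set hx _ => exact hx

theorem HTame.of_E {x y : ZFSet.{0}} (h : HTame x) (hy : E y x) : HTame y := by
  cases h with
  | node l =>
    obtain ⟨n, rfl⟩ := E_node.1 hy
    exact .node _
  | set _ h => exact h y hy

theorem Tame.smul (h : treeAut) {x : ZFSet.{0}} (hx : Tame x) : Tame (h • x) := by
  obtain ⟨F, c, hF⟩ := hx
  refine ⟨F.image h.1, h.1 c, fun g hg => ?_⟩
  have key : ∀ l, g.1 (h.1 l) = h.1 l → (h⁻¹ * g * h).1 l = l := fun l hl => by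
    simp [hl]
  have conj : ∀ y : ZFSet.{0}, (h⁻¹ * g * h) • y = y → g • h • y = h • y := fun y hy => by
    rwa [mul_smul, mul_smul, inv_smul_eq_iff] at hy
  obtain ⟨h₁, h₂⟩ := hF (h⁻¹ * g * h) fun l hl => key l (hg _ (Finset.mem_image_of_mem _ hl))
  refine ⟨conj x h₁, fun hc z hz => ?_⟩
  obtain ⟨y, hy, rfl⟩ := E_smul.1 hz
  refine conj y (h₂ (fun n => key _ ?_) y hy)
  obtain ⟨m, hm⟩ := treeAut_cons h n c
  rw [hm, hc]

theorem HTame.smul (g : treeAut) {x : ZFSet.{0}} (hx : HTame x) : HTame (g • x) := by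
  induction hx with
  | node l => exact smul_node g l ▸ .node _
  | set hx _ ih =>
    refine .set (hx.smul g) fun z hz => ?_
    obtain ⟨y, hy, rfl⟩ := E_smul.1 hz
    exact ih y hy

/-- The model of `ZF − Union`. -/
def Model : Type 1 := {x : ZFSet.{0} // HTame x}

namespace Model

/-- Membership in the model. -/
def mem (y x : Model) : Prop := E y.1 x.1

/-- A node of the tree as an element of the model. -/
noncomputable def ofNode (l : List ℕ) : Model := ⟨node l, .node l⟩

noncomputable instance : MulAction treeAut Model where
  smul g x := ⟨g • x.1, x.2.smul g⟩
  one_smul x := Subtype.ext (one_smul _ x.1)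
  mul_smul g h x := Subtype.ext (mul_smul g h x.1)

theorem coe_smul (g : treeAut) (x : Model) : (g • x).1 = g • x.1 := rfl

theorem smul_mem_smul {g : treeAut} {x y : Model} : mem (g • y) (g • x) ↔ mem y x := smul_E_smul

theorem mem_smul_iff {g : treeAut} {x z : Model} : mem z (g • x) ↔ mem (g⁻¹ • z) x := by
  rw [← smul_mem_smul (g := g) (y := g⁻¹ • z), smul_inv_smul]

theorem smul_ofNode (g : treeAut) (l : List ℕ) : g • ofNode l = ofNode (g.1 l) :=
  Subtype.ext (smul_node g l)

theorem ofNode_injective : Function.Injective ofNode := fun _ _ h =>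
  node_injective (congrArg Subtype.val h)

theorem mem_ofNode {l : List ℕ} {y : Model} : mem y (ofNode l) ↔ ∃ n, y = ofNode (n :: l) :=
  E_node.trans (exists_congr fun n => (Subtype.ext_iff (a1 := y) (a2 := ofNode (n :: l))).symm)

theorem ext {x y : Model} (h : ∀ z, mem z x ↔ mem z y) : x = y :=
  Subtype.ext (E_ext fun z => ⟨fun hz => (h ⟨z, x.2.of_E hz⟩).1 hz,
    fun hz => (h ⟨z, y.2.of_E hz⟩).2 hz⟩)

instance small_setOf_mem (x : Model) : Small.{0} {y | mem y x} :=
  small_of_injective (β := {y | E y x.1}) (f := fun y => ⟨y.1.1, y.2⟩) fun _ _ h =>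
    Subtype.ext (Subtype.ext (Subtype.mk.inj h))

theorem tame (x : Model) : ∃ (F : Finset (List ℕ)) (c : List ℕ), ∀ g : treeAut,
    (∀ l ∈ F, g.1 l = l) →
      g • x = x ∧ ((∀ n, g.1 (n :: c) = n :: c) → ∀ y, mem y x → g • y = y) := by
  obtain ⟨F, c, h⟩ := x.2.tame
  exact ⟨F, c, fun g hg => ⟨Subtype.ext (h g hg).1,
    fun hc y hy => Subtype.ext ((h g hg).2 hc y.1 hy)⟩⟩

/-- A small class whose support and joint support of members are as in `Tame` is a set. -/
theorem exists_mem_iff (S : Set Model) [Small.{0} S] (F : Finset (List ℕ)) (c : List ℕ)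
    (h : ∀ g : treeAut, (∀ l ∈ F, g.1 l = l) → (∀ z ∈ S, g • z ∈ S) ∧
      ((∀ n, g.1 (n :: c) = n :: c) → ∀ z ∈ S, g • z = z)) :
    ∃ s : Model, ∀ z, mem z s ↔ z ∈ S := by
  obtain ⟨s, hs⟩ := exists_E_iff (Set.image (fun z : Model => z.1) S)
  have hE : ∀ y, E y s → HTame y := fun y hy => by
    obtain ⟨z, _, rfl⟩ := (hs y).1 hy
    exact z.2
  refine ⟨⟨s, .set ⟨F, c, fun g hg => ⟨E_ext fun z => ?_, fun hc y hy => ?_⟩⟩ hE⟩, fun z => ?_⟩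
  · rw [E_smul, hs]
    constructor
    · rintro ⟨y, hy, rfl⟩
      obtain ⟨w, hw, rfl⟩ := (hs y).1 hy
      exact ⟨g • w, (h g hg).1 w hw, rfl⟩
    · rintro ⟨z, hz, rfl⟩
      refine ⟨(g⁻¹ • z).1, (hs _).2 ⟨_, (h g⁻¹ fun l hl => ?_).1 z hz, rfl⟩, ?_⟩
      · exact (Equiv.Perm.inv_eq_iff_eq).2 (hg l hl).symm
      · rw [coe_smul, smul_inv_smul]
  · obtain ⟨w, hw, rfl⟩ := (hs y).1 hy
    exact congrArg Subtype.val ((h g hg).2 hc w hw)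
  · refine (hs z.1).trans ⟨?_, fun hz => ⟨z, hz, rfl⟩⟩
    rintro ⟨y, hy, hyz⟩
    exact Subtype.ext hyz ▸ hy

/-- Finitely many elements have a common finite support. -/
theorem exists_support {n : ℕ} (p : Fin n → Model) :
    ∃ F : Finset (List ℕ), ∀ g : treeAut, (∀ l ∈ F, g.1 l = l) → ∀ i, g • p i = p i := by
  choose F c h using fun i => (p i).tame
  refine ⟨Finset.univ.biUnion F, fun g hg i => (h i g fun l hl => hg l ?_).1⟩
  exact Finset.mem_biUnion.2 ⟨i, Finset.mem_univ i, hl⟩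

theorem realize_smul {α : Type} (g : treeAut) (φ : Lmem.Formula α) (v : α → Model) :
    letI := memStructure mem
    φ.Realize (fun i => g • v i) ↔ φ.Realize v := by
  let _ := memStructure mem
  let e : Model ≃[Lmem] Model :=
    { MulAction.toPerm g with
      map_fun' := fun f => f.elim
      map_rel' := fun r x => by
        cases r
        exact smul_mem_smul }
  exact StrongHomClass.realize_formula e φ

/-! ### Tree automorphisms permuting two children of a node -/

/-- The map on nodes exchanging the subtrees above `n :: d` and `m :: d`. -/
def swapFun (d : List ℕ) (n m : ℕ) : List ℕ → List ℕ
  | [] => []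
  | k :: l => (if l = d then Equiv.swap n m k else k) :: swapFun d n m l

theorem swapFun_eq_self {d : List ℕ} {n m : ℕ} {l : List ℕ} (hn : ¬ n :: d <:+ l)
    (hm : ¬ m :: d <:+ l) : swapFun d n m l = l := by
  induction l with
  | nil => rfl
  | cons k l ih =>
    rw [List.suffix_cons_iff, not_or] at hn hm
    rw [swapFun, ih hn.2 hm.2]
    split_ifs with h
    · subst h
      rw [Equiv.swap_apply_of_ne_of_ne]
      · rintro rfl; exact hn.1 rfl
      · rintro rfl; exact hm.1 rfl
    · rfl

theorem swapFun_eq_self_of_length_le {d : List ℕ} {n m : ℕ} {l : List ℕ}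
    (h : l.length ≤ d.length) : swapFun d n m l = l :=
  swapFun_eq_self (fun hs => by have := hs.length_le; simp at this; omega)
    (fun hs => by have := hs.length_le; simp at this; omega)

theorem length_swapFun (d : List ℕ) (n m : ℕ) (l : List ℕ) :
    (swapFun d n m l).length = l.length := by
  induction l with
  | nil => rfl
  | cons k l ih => rw [swapFun, List.length_cons, ih, List.length_cons]

theorem swapFun_eq_iff {d : List ℕ} {n m : ℕ} {l : List ℕ} : swapFun d n m l = d ↔ l = d := by
  constructor
  · intro h
    have hl := length_swapFun d n m l
    rw [h] at hl
    rwa [swapFun_eq_self_of_length_le hl.ge] at h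
  · rintro rfl
    exact swapFun_eq_self_of_length_le le_rfl

theorem swapFun_involutive (d : List ℕ) (n m : ℕ) : Function.Involutive (swapFun d n m) := by
  intro l
  induction l with
  | nil => rfl
  | cons k l ih =>
    simp only [swapFun, ih, swapFun_eq_iff]
    split_ifs <;> simp

/-- The tree automorphism exchanging the subtrees above `n :: d` and `m :: d`. -/
def swapAut (d : List ℕ) (n m : ℕ) : treeAut :=
  ⟨(swapFun_involutive d n m).toPerm, fun l => by
    cases l <;> rfl⟩

theorem swapAut_apply (d : List ℕ) (n m : ℕ) (l : List ℕ) :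
    (swapAut d n m).1 l = swapFun d n m l := rfl

theorem swapAut_cons_left (d : List ℕ) (n m : ℕ) : (swapAut d n m).1 (n :: d) = m :: d := by
  rw [swapAut_apply, swapFun, if_pos rfl, Equiv.swap_apply_left,
    swapFun_eq_self_of_length_le le_rfl]

/-! ### The axioms -/

theorem axExt : AxExt Model mem := fun _ _ => ext

theorem axPairing : AxPairing Model mem := fun a b => by
  obtain ⟨F, hF⟩ := exists_support ![a, b]
  have : Small.{0} {z | z = a ∨ z = b} := inferInstanceAs (Small.{0} ({a, b} : Set Model))
  refine exists_mem_iff {z | z = a ∨ z = b} F [] fun g hg => ?_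
  have ha : g • a = a := hF g hg 0
  have hb : g • b = b := hF g hg 1
  constructor
  · rintro z (rfl | rfl)
    · exact Or.inl ha
    · exact Or.inr hb
  · rintro - z (rfl | rfl)
    · exact ha
    · exact hb

theorem axPower : AxPower Model mem := fun x => by
  obtain ⟨F, c, h⟩ := x.tame
  have : Small.{0} {z | ∀ w, mem w z → mem w x} :=
    small_of_injective (β := Set {w | mem w x}) (f := fun z => {w | mem w.1 z.1})
      fun a b hab => Subtype.ext <| ext fun w =>
        ⟨fun hw => (Set.ext_iff.1 hab ⟨w, a.2 w hw⟩).1 hw,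
          fun hw => (Set.ext_iff.1 hab ⟨w, b.2 w hw⟩).2 hw⟩
  refine exists_mem_iff {z | ∀ w, mem w z → mem w x} F c fun g hg =>
    ⟨fun z hz w hw => ?_, fun hc z hz => ext fun w => ?_⟩
  · rw [← (h g hg).1, mem_smul_iff]
    exact hz _ (mem_smul_iff.1 hw)
  · have fixed := (h g hg).2 hc
    constructor
    · intro hw
      have hw' := mem_smul_iff.1 hw
      have := fixed _ (hz _ hw')
      rw [smul_inv_smul] at this
      rwa [← this] at hw'
    · intro hw
      rw [← fixed w (hz w hw)]
      exact smul_mem_smul.2 hw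

theorem axComp : AxComp Model mem := fun n φ x p => by
  obtain ⟨F, c, h⟩ := x.tame
  obtain ⟨F₂, h₂⟩ := exists_support p
  let _ := memStructure mem
  have : Small.{0} {z | mem z x ∧ φ.Realize (Fin.cons z p : Fin (n + 1) → Model)} :=
    small_subset (s := {z | mem z x}) fun z hz => hz.1
  refine exists_mem_iff {z | mem z x ∧ φ.Realize (Fin.cons z p : Fin (n + 1) → Model)}
    (F ∪ F₂) c fun g hg => ?_
  have hx := h g fun l hl => hg l (Finset.mem_union_left _ hl)
  have hp := h₂ g fun l hl => hg l (Finset.mem_union_right _ hl)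
  refine ⟨fun z hz => ⟨?_, ?_⟩, fun hc z hz => hx.2 hc z hz.1⟩
  · rw [← hx.1]
    exact smul_mem_smul.2 hz.1
  · rw [show (Fin.cons (g • z) p : Fin (n + 1) → Model) =
      fun i => g • (Fin.cons z p : Fin (n + 1) → Model) i from
        funext (Fin.cases rfl fun i => (hp i).symm)]
    exact (realize_smul g φ _).2 hz.2

theorem axRepl : AxRepl Model mem := fun n φ a p hφ => by
  obtain ⟨F, c, h⟩ := a.tame
  obtain ⟨F₂, h₂⟩ := exists_support p
  let _ := memStructure mem
  let r (x y : Model) : Prop :=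
    φ.Realize (Fin.cons x (Fin.cons y p : Fin (n + 1) → Model) : Fin (n + 2) → Model)
  have hr : ∀ x, mem x a → ∃! y, r x y := hφ
  have : Nonempty Model := ⟨a⟩
  choose! f hf hfu using hr
  have : Small.{0} {y | ∃ x, mem x a ∧ r x y} :=
    small_subset (s := Set.range fun x : {x | mem x a} => f x.1) <| by
      rintro y ⟨x, hx, hy⟩
      exact ⟨⟨x, hx⟩, (hfu x hx y hy).symm⟩
  refine exists_mem_iff {y | ∃ x, mem x a ∧ r x y} (F ∪ F₂) c fun g hg => ?_
  have ha := h g fun l hl => hg l (Finset.mem_union_left _ hl)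
  have hp := h₂ g fun l hl => hg l (Finset.mem_union_right _ hl)
  have hgr : ∀ x y, r x y → r (g • x) (g • y) := fun x y hxy => by
    have := (realize_smul g φ _).2 hxy
    convert this using 1
    exact funext (Fin.cases rfl (Fin.cases rfl fun i => (hp i).symm))
  constructor
  · rintro y ⟨x, hx, hxy⟩
    refine ⟨g • x, ?_, hgr x y hxy⟩
    rw [← ha.1]
    exact smul_mem_smul.2 hx
  · rintro hc y ⟨x, hx, hxy⟩
    have := hgr x y hxy
    rw [ha.2 hc x hx] at this
    exact (hfu x hx _ this).trans (hfu x hx y hxy).symm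

theorem exists_succ (x : Model) : ∃ s, ∀ z, mem z s ↔ (mem z x ∨ z = x) := by
  obtain ⟨F, c, h⟩ := x.tame
  have : Small.{0} {z | mem z x ∨ z = x} :=
    inferInstanceAs (Small.{0} ({z | mem z x} ∪ {x} : Set Model))
  refine exists_mem_iff {z | mem z x ∨ z = x} F c fun g hg => ?_
  obtain ⟨hx, hc⟩ := h g hg
  constructor
  · rintro z (hz | rfl)
    · left
      rw [← hx]
      exact smul_mem_smul.2 hz
    · exact Or.inr hx
  · rintro hgc z (hz | rfl)
    · exact hc hgc z hz
    · exact hx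

theorem axInfinity : AxInfinity Model mem := by
  obtain ⟨e, he⟩ := exists_mem_iff (∅ : Set Model) ∅ [] (by simp)
  choose s hs using exists_succ
  let num (n : ℕ) : Model := s^[n] e
  have hnum : ∀ n, num (n + 1) = s (num n) := fun n => Function.iterate_succ_apply' s n e
  have fixed : ∀ (g : treeAut) n, g • num n = num n := fun g n => by
    induction n with
    | zero =>
      refine ext fun z => ?_
      rw [mem_smul_iff]
      exact ⟨fun h => ((he _).1 h).elim, fun h => ((he _).1 h).elim⟩
    | succ n ih =>
      refine ext fun z => ?_
      rw [mem_smul_iff, hnum, hs, hs, ← mem_smul_iff, ih, inv_smul_eq_iff, ih]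
  obtain ⟨I, hI⟩ := exists_mem_iff (Set.range num) ∅ [] fun g _ => by simp [fixed]
  refine ⟨I, ⟨e, (hI e).2 ⟨0, rfl⟩, fun z => by simp [he]⟩, fun x hx => ?_⟩
  obtain ⟨n, rfl⟩ := (hI x).1 hx
  exact ⟨s (num n), (hI _).2 ⟨n + 1, hnum n⟩, hs _⟩

theorem axFound : AxFound Model mem := fun x hx => by
  by_contra! H
  obtain ⟨F, c, h⟩ := x.tame
  by_cases hn : ∃ l, mem (ofNode l) x
  · have step : ∀ l, mem (ofNode l) x → ∃ n, mem (ofNode (n :: l)) x := fun l hl => by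
      obtain ⟨z, hz, hzx⟩ := H _ hl
      obtain ⟨n, rfl⟩ := mem_ofNode.1 hz
      exact ⟨n, hzx⟩
    have long : ∀ N, ∃ l, N ≤ l.length ∧ mem (ofNode l) x := fun N => by
      induction N with
      | zero => exact hn.imp fun l hl => ⟨Nat.zero_le _, hl⟩
      | succ N ih =>
        obtain ⟨l, hN, hl⟩ := ih
        obtain ⟨n, hn⟩ := step l hl
        exact ⟨n :: l, by simpa using hN, hn⟩
    obtain ⟨l, hN, hl⟩ := long (F.sup List.length + (c.length + 1))
    obtain ⟨n, hn⟩ := step l hl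
    have hfix := (h (swapAut l n (n + 1)) fun k hk => swapFun_eq_self_of_length_le <| by
      have := Finset.le_sup (f := List.length) hk
      omega).2 (fun k => swapFun_eq_self_of_length_le (by rw [List.length_cons]; omega)) _ hn
    rw [smul_ofNode, swapAut_cons_left] at hfix
    simpa using ofNode_injective hfix
  · obtain ⟨y, hy, hmin⟩ := (InvImage.wf (fun y : Model => y.1.rank)
      wellFounded_lt).has_min {y | mem y x} hx
    obtain ⟨z, hz, hzx⟩ := H y hy
    refine hmin z hzx (rank_lt_of_E (fun l hl => hn ⟨l, ?_⟩) hz)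
    rwa [show ofNode l = y from Subtype.ext hl.symm]

/-- The children of two distinct nodes of the same height do not form a set. -/
theorem not_exists_union :
    ¬ ∃ u, ∀ z, mem z u ↔ (mem z (ofNode [0]) ∨ mem z (ofNode [1])) := by
  rintro ⟨u, hu⟩
  obtain ⟨F, c, h⟩ := u.tame
  obtain ⟨d, hdc, hd⟩ : ∃ d, d ≠ c ∧ ∀ n, mem (ofNode (n :: d)) u := by
    by_cases hc : [0] = c
    · exact ⟨[1], by rw [← hc]; decide, fun n => (hu _).2 (Or.inr (mem_ofNode.2 ⟨n, rfl⟩))⟩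
    · exact ⟨[0], hc, fun n => (hu _).2 (Or.inl (mem_ofNode.2 ⟨n, rfl⟩))⟩
  obtain ⟨N, hN⟩ : ∃ N, ∀ l ∈ insert c F, ∀ k ∈ l, k < N := by
    refine ⟨(insert c F).sup List.sum + 1, fun l hl k hk => Nat.lt_succ_of_le ?_⟩
    exact (List.le_sum_of_mem hk).trans (Finset.le_sup (f := List.sum) hl)
  have hsuff : ∀ l ∈ insert c F, ∀ n, N ≤ n → ¬ n :: d <:+ l := fun l hl n hn hs =>
    absurd (hN l hl n (hs.subset List.mem_cons_self)) (by omega)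
  have hfix := (h (swapAut d N (N + 1)) fun l hl => swapFun_eq_self
    (hsuff l (Finset.mem_insert_of_mem hl) _ le_rfl)
    (hsuff l (Finset.mem_insert_of_mem hl) _ (Nat.le_succ N))).2 (fun k => ?_) _ (hd N)
  · rw [smul_ofNode, swapAut_cons_left] at hfix
    simpa using ofNode_injective hfix
  · have hk : ∀ n, N ≤ n → ¬ n :: d <:+ k :: c := fun n hn hs => by
      rcases List.suffix_cons_iff.1 hs with hs | hs
      · exact hdc (List.cons.inj hs).2
      · exact hsuff c (Finset.mem_insert_self c F) n hn hs
    exact swapFun_eq_self (hk N le_rfl) (hk _ (Nat.le_succ N))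

end Model

end TreeModel

/-- **ZF − Union does not prove the Finite Union principle.** There is a model of
ZF − Union containing elements `x` and `y` such that no element `u` of the model
satisfies `∀ z (z ∈ u ↔ z ∈ x ∨ z ∈ y)`; equivalently, the theory
(ZF − Union) ∪ {¬∀x∀y∃u∀z (z ∈ u ↔ z ∈ x ∨ z ∈ y)} is satisfiable. -/
theorem ZFminusUnion_not_proves_finUnion :
    ∃ (M : Type 1) (mem : M → M → Prop),
      ZFminusUnion M mem ∧
        ∃ x y : M, ¬ ∃ u : M, ∀ z, mem z u ↔ (mem z x ∨ mem z y) := by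
  open TreeModel.Model in
  exact ⟨TreeModel.Model, mem,
    ⟨axExt, axPairing, axPower, axInfinity, axFound, axComp, axRepl⟩,
    ofNode [0], ofNode [1], not_exists_union⟩
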